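/- arXiv:2005.08487 — 2 statements merged into one kernel-verified Lean document; each statement's English description precedes it below -/
import Mathlib

section
/- Let $X\in[0,1]^{N\times N}$ satisfy $\|D^T X\|_0+\|XD\|_0\leq s$, and let $q\in\mathbb{R}^{N\times N}$ satisfy $\|D^{-1}(X-q)D^{-T}\|_{\max}\leq\delta/2$ for some $\delta>0$. Let $\hat{X}$ be any minimizer of $\|D^T Z\|_1+\|ZD\|_1$ over all $Z\in\mathbb{R}^{N\times N}$ with $\|D^{-1}(Z-q)D^{-T}\|_{\max}\leq\delta/2$. Then $\|\hat{X}-X\|_F\leq C\sqrt{s}\,\delta$ for an absolute constant $C$ (independent of $N$, $s$, $\delta$, and $X$). -/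
open scoped BigOperators
open Finset Matrix

/-- The `N × N` finite difference matrix with `1`s on the diagonal and `-1`s on
the subdiagonal. -/
noncomputable def Dmat (N : ℕ) : Matrix (Fin N) (Fin N) ℝ :=
  Matrix.of fun i j => if i = j then 1 else if (j : ℕ) + 1 = (i : ℕ) then -1 else 0

/-- Entrywise ℓ¹ norm of a matrix. -/
noncomputable def m1 {N : ℕ} (A : Matrix (Fin N) (Fin N) ℝ) : ℝ := ∑ i, ∑ j, |A i j|

/-- Number of nonzero entries of a matrix. -/
noncomputable def msupp {N : ℕ} (A : Matrix (Fin N) (Fin N) ℝ) : ℕ :=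
  (Finset.univ.filter (fun p : Fin N × Fin N => A p.1 p.2 ≠ 0)).card

/-- Frobenius norm of a matrix. -/
noncomputable def frob {N : ℕ} (A : Matrix (Fin N) (Fin N) ℝ) : ℝ :=
  Real.sqrt (∑ i, ∑ j, (A i j) ^ 2)

lemma sd_D_col (N : ℕ) (j : Fin N) : ∑ i, |Dmat N i j| ≤ 2 := by
  have h : ∀ i, |Dmat N i j| ≤ (if i = j then 1 else 0) + (if (j : ℕ) + 1 = (i : ℕ) then 1 else 0) := by
    intro i
    simp only [Dmat, Matrix.of_apply]
    split_ifs <;> simp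
  refine (Finset.sum_le_sum fun i _ => h i).trans ?_
  rw [Finset.sum_add_distrib]
  have h1 : ∑ i : Fin N, (if i = j then (1 : ℝ) else 0) = 1 := by simp
  have h2 : ∑ i : Fin N, (if (j : ℕ) + 1 = (i : ℕ) then (1 : ℝ) else 0) ≤ 1 := by
    rw [Finset.sum_boole]
    have : (Finset.univ.filter (fun i : Fin N => (j : ℕ) + 1 = (i : ℕ))).card ≤ 1 := by
      rw [Finset.card_le_one]
      intro a ha b hb
      simp only [Finset.mem_filter, Finset.mem_univ, true_and] at ha hb
      apply Fin.ext
      omega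
    exact_mod_cast this
  linarith

lemma sd_D_row (N : ℕ) (i : Fin N) : ∑ j, |Dmat N i j| ≤ 2 := by
  have h : ∀ j, |Dmat N i j| ≤ (if i = j then 1 else 0) + (if (j : ℕ) + 1 = (i : ℕ) then 1 else 0) := by
    intro j
    simp only [Dmat, Matrix.of_apply]
    split_ifs <;> simp
  refine (Finset.sum_le_sum fun i _ => h i).trans ?_
  rw [Finset.sum_add_distrib]
  have h1 : ∑ j : Fin N, (if i = j then (1 : ℝ) else 0) = 1 := by simp
  have h2 : ∑ j : Fin N, (if (j : ℕ) + 1 = (i : ℕ) then (1 : ℝ) else 0) ≤ 1 := by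
    rw [Finset.sum_boole]
    have : (Finset.univ.filter (fun j : Fin N => (j : ℕ) + 1 = (i : ℕ))).card ≤ 1 := by
      rw [Finset.card_le_one]
      intro a ha b hb
      simp only [Finset.mem_filter, Finset.mem_univ, true_and] at ha hb
      apply Fin.ext
      omega
    exact_mod_cast this
  linarith

lemma sd_D_det (N : ℕ) : (Dmat N).det = 1 := by
  rw [Matrix.det_of_isLowerTriangular]
  · simp [Dmat]
  · intro i j hij
    have hij' : i < j := by simpa using hij
    have h1 : (i : ℕ) < (j : ℕ) := hij'
    simp only [Dmat, Matrix.of_apply]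
    rw [if_neg (ne_of_lt hij'), if_neg (by omega)]

lemma sd_m1_mul (N : ℕ) (A : Matrix (Fin N) (Fin N) ℝ) : m1 (A * Dmat N) ≤ 2 * m1 A := by
  unfold m1
  rw [Finset.mul_sum]
  refine Finset.sum_le_sum fun i _ => ?_
  calc ∑ j, |(A * Dmat N) i j| ≤ ∑ j, ∑ k, |A i k| * |Dmat N k j| := by
        refine Finset.sum_le_sum fun j _ => ?_
        rw [Matrix.mul_apply]
        refine (Finset.abs_sum_le_sum_abs _ _).trans (le_of_eq ?_)
        simp only [abs_mul]
    _ = ∑ k, |A i k| * ∑ j, |Dmat N k j| := by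
        rw [Finset.sum_comm]
        simp only [Finset.mul_sum]
    _ ≤ ∑ k, |A i k| * 2 :=
        Finset.sum_le_sum fun k _ => mul_le_mul_of_nonneg_left (sd_D_row N k) (abs_nonneg _)
    _ = 2 * ∑ j, |A i j| := by rw [← Finset.sum_mul, mul_comm]

lemma sd_frob_mul (N : ℕ) (H : Matrix (Fin N) (Fin N) ℝ) :
    ∑ i, ∑ j, (((Dmat N)ᵀ * H) i j) ^ 2 ≤ 4 * ∑ i, ∑ j, (H i j) ^ 2 := by
  have key : ∀ i j, (((Dmat N)ᵀ * H) i j) ^ 2 ≤ 2 * ∑ k, |Dmat N k i| * (H k j) ^ 2 := by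
    intro i j
    rw [Matrix.mul_apply]
    have h := Finset.sum_sq_le_sum_mul_sum_of_sq_eq_mul (Finset.univ : Finset (Fin N))
      (r := fun k => (Dmat N)ᵀ i k * H k j)
      (f := fun k => |Dmat N k i|) (g := fun k => |Dmat N k i| * (H k j) ^ 2)
      (fun k _ => abs_nonneg _) (fun k _ => by positivity)
      (fun k _ => by
        simp only [Matrix.transpose_apply]
        rw [mul_pow, ← sq_abs (Dmat N k i)]; ring)
    refine h.trans ?_
    exact mul_le_mul_of_nonneg_right (sd_D_col N i)
      (Finset.sum_nonneg fun k _ => by positivity)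
  calc ∑ i, ∑ j, (((Dmat N)ᵀ * H) i j) ^ 2
      ≤ ∑ i, ∑ j, 2 * ∑ k, |Dmat N k i| * (H k j) ^ 2 :=
        Finset.sum_le_sum fun i _ => Finset.sum_le_sum fun j _ => key i j
    _ = 2 * ∑ j, ∑ k, (∑ i, |Dmat N k i|) * (H k j) ^ 2 := by
        rw [Finset.sum_comm, Finset.mul_sum]
        refine Finset.sum_congr rfl fun j _ => ?_
        rw [← Finset.mul_sum, Finset.sum_comm]
        simp only [Finset.sum_mul]
    _ ≤ 2 * ∑ j, ∑ k, 2 * (H k j) ^ 2 := by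
        refine mul_le_mul_of_nonneg_left ?_ (by norm_num)
        exact Finset.sum_le_sum fun j _ => Finset.sum_le_sum fun k _ =>
          mul_le_mul_of_nonneg_right (sd_D_row N k) (sq_nonneg _)
    _ = 4 * ∑ i, ∑ j, (H i j) ^ 2 := by
        rw [Finset.sum_comm]
        simp only [← Finset.mul_sum]
        ring

lemma sd_frob_mul' (N : ℕ) (H : Matrix (Fin N) (Fin N) ℝ) :
    ∑ i, ∑ j, ((H * Dmat N) i j) ^ 2 ≤ 4 * ∑ i, ∑ j, (H i j) ^ 2 := by
  have h := sd_frob_mul N Hᵀ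
  rw [← Matrix.transpose_mul] at h
  simp only [Matrix.transpose_apply] at h
  rw [Finset.sum_comm] at h
  rw [Finset.sum_comm (f := fun i j => (H i j) ^ 2)]
  exact h

lemma sd_cone {N : ℕ} (A B : Matrix (Fin N) (Fin N) ℝ) (s : ℕ) (F : ℝ)
    (hs : msupp A ≤ s) (hF : ∑ i, ∑ j, ((B - A) i j) ^ 2 ≤ 4 * F ^ 2) (hF0 : 0 ≤ F) :
    m1 (B - A) ≤ m1 B - m1 A + 4 * (Real.sqrt s * F) := by
  classical
  set S := Finset.univ.filter (fun p : Fin N × Fin N => A p.1 p.2 ≠ 0) with hS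
  have e : ∀ M : Matrix (Fin N) (Fin N) ℝ, m1 M = ∑ p : Fin N × Fin N, |M p.1 p.2| := by
    intro M
    rw [Fintype.sum_prod_type]
    rfl
  have pt : ∀ p : Fin N × Fin N, |(B - A) p.1 p.2| ≤ |B p.1 p.2| - |A p.1 p.2| +
      2 * (if A p.1 p.2 ≠ 0 then |(B - A) p.1 p.2| else 0) := by
    intro p
    simp only [Matrix.sub_apply]
    split_ifs with h
    · have := abs_sub_abs_le_abs_sub (A p.1 p.2) (B p.1 p.2)
      rw [abs_sub_comm] at this
      linarith
    · have h : A p.1 p.2 = 0 := not_not.mp h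
      simp [h]
  have h1 : m1 (B - A) ≤ m1 B - m1 A + 2 * ∑ p ∈ S, |(B - A) p.1 p.2| := by
    rw [e, e, e, hS, Finset.sum_filter, Finset.mul_sum, ← Finset.sum_sub_distrib,
      ← Finset.sum_add_distrib]
    exact Finset.sum_le_sum fun p _ => pt p
  have h2 : (∑ p ∈ S, |(B - A) p.1 p.2|) ^ 2 ≤ (2 * (Real.sqrt s * F)) ^ 2 := by
    have hc := sq_sum_le_card_mul_sum_sq (s := S) (f := fun p => |(B - A) p.1 p.2|)
    refine hc.trans ?_
    have hcard : (S.card : ℝ) ≤ s := by exact_mod_cast hs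
    have hsum : ∑ p ∈ S, |(B - A) p.1 p.2| ^ 2 ≤ 4 * F ^ 2 := by
      refine le_trans ?_ hF
      rw [← Fintype.sum_prod_type']
      simp only [sq_abs]
      exact Finset.sum_le_sum_of_subset_of_nonneg (Finset.subset_univ _)
        fun p _ _ => sq_nonneg _
    have : (2 * (Real.sqrt s * F)) ^ 2 = s * (4 * F ^ 2) := by
      rw [mul_pow, mul_pow, Real.sq_sqrt (Nat.cast_nonneg s)]; ring
    rw [this]
    exact mul_le_mul hcard hsum (Finset.sum_nonneg fun p _ => by positivity) (Nat.cast_nonneg s)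
  have h3 := abs_le_of_sq_le_sq h2 (by positivity)
  have h4 := (abs_le.mp (abs_le_of_sq_le_sq h2 (by positivity))).2
  linarith

lemma sd_dual {N : ℕ} (H U : Matrix (Fin N) (Fin N) ℝ) (δ : ℝ)
    (hH : H = Dmat N * U * (Dmat N)ᵀ) (hU : ∀ i j, |U i j| ≤ δ) :
    ∑ i, ∑ j, (H i j) ^ 2 ≤ δ * m1 ((Dmat N)ᵀ * H * Dmat N) := by
  have tr : ∀ A B : Matrix (Fin N) (Fin N) ℝ, (Aᵀ * B).trace = ∑ i, ∑ j, A i j * B i j := by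
    intro A B
    rw [Finset.sum_comm]
    simp [Matrix.trace, Matrix.mul_apply]
  have h1 : ∑ i, ∑ j, (H i j) ^ 2 = ((((Dmat N)ᵀ * H * Dmat N)ᵀ) * U).trace := by
    have h2 : ∑ i, ∑ j, (H i j) ^ 2 = (Hᵀ * H).trace := by
      rw [tr]; simp only [sq]
    rw [h2]
    nth_rewrite 2 [hH]
    rw [← Matrix.mul_assoc, Matrix.trace_mul_comm]
    simp only [Matrix.transpose_mul, Matrix.transpose_transpose, Matrix.mul_assoc]
  rw [h1, tr]
  unfold m1
  rw [Finset.mul_sum]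
  refine Finset.sum_le_sum fun i _ => ?_
  rw [Finset.mul_sum]
  refine Finset.sum_le_sum fun j _ => ?_
  refine (le_abs_self _).trans ?_
  rw [abs_mul, mul_comm]
  exact mul_le_mul_of_nonneg_right (hU i j) (abs_nonneg _)

/-- there is an absolute constant `C` such that the 2D TV decoder
applied to a first-order 2D Sigma Delta quantization of an image `X` with
`‖DᵀX‖₀ + ‖XD‖₀ ≤ s` satisfies `‖X̂ - X‖_F ≤ C √s δ`. -/
theorem sigma_delta_2d_decoder_error :
    ∃ C : ℝ, 0 < C ∧
      ∀ (N s : ℕ) (δ : ℝ), 0 < δ →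
      ∀ (X q : Matrix (Fin N) (Fin N) ℝ),
        (∀ i j, X i j ∈ Set.Icc (0 : ℝ) 1) →
        msupp ((Dmat N)ᵀ * X) + msupp (X * Dmat N) ≤ s →
        (∀ i j, |((Dmat N)⁻¹ * (X - q) * ((Dmat N)⁻¹)ᵀ) i j| ≤ δ / 2) →
        ∀ Xhat : Matrix (Fin N) (Fin N) ℝ,
          (∀ i j, |((Dmat N)⁻¹ * (Xhat - q) * ((Dmat N)⁻¹)ᵀ) i j| ≤ δ / 2) →
          (∀ Z : Matrix (Fin N) (Fin N) ℝ,
            (∀ i j, |((Dmat N)⁻¹ * (Z - q) * ((Dmat N)⁻¹)ᵀ) i j| ≤ δ / 2) →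
            m1 ((Dmat N)ᵀ * Xhat) + m1 (Xhat * Dmat N) ≤
              m1 ((Dmat N)ᵀ * Z) + m1 (Z * Dmat N)) →
          frob (Xhat - X) ≤ C * Real.sqrt s * δ := by
  refine ⟨16, by norm_num, ?_⟩
  intro N s δ hδ X q _ hs hX Xhat hXhat hmin
  have hmin := hmin X hX
  set H := Xhat - X with hHdef
  set F := frob H with hFdef
  have hF0 : 0 ≤ F := Real.sqrt_nonneg _
  have hFsq : F ^ 2 = ∑ i, ∑ j, (H i j) ^ 2 :=
    Real.sq_sqrt (Finset.sum_nonneg fun i _ => Finset.sum_nonneg fun j _ => sq_nonneg _)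
  have hunit : IsUnit (Dmat N).det := by rw [sd_D_det]; exact isUnit_one
  set U := (Dmat N)⁻¹ * H * ((Dmat N)⁻¹)ᵀ with hUdef
  have hHU : H = Dmat N * U * (Dmat N)ᵀ := by
    have e1 : Dmat N * U * (Dmat N)ᵀ
        = (Dmat N * (Dmat N)⁻¹) * H * (Dmat N * (Dmat N)⁻¹)ᵀ := by
      rw [hUdef, Matrix.transpose_mul]
      simp only [Matrix.mul_assoc]
    rw [e1, Matrix.mul_nonsing_inv _ hunit]
    simp
  have hU : ∀ i j, |U i j| ≤ δ := by
    intro i j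
    have e2 : U = (Dmat N)⁻¹ * (Xhat - q) * ((Dmat N)⁻¹)ᵀ
        - (Dmat N)⁻¹ * (X - q) * ((Dmat N)⁻¹)ᵀ := by
      rw [← Matrix.sub_mul, ← Matrix.mul_sub, sub_sub_sub_cancel_right]
    rw [e2, Matrix.sub_apply]
    have := abs_sub (((Dmat N)⁻¹ * (Xhat - q) * ((Dmat N)⁻¹)ᵀ) i j)
      (((Dmat N)⁻¹ * (X - q) * ((Dmat N)⁻¹)ᵀ) i j)
    linarith [hXhat i j, hX i j]
  have hd := sd_dual H U δ hHU hU
  have hm := sd_m1_mul N ((Dmat N)ᵀ * H)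
  have c1 := sd_cone ((Dmat N)ᵀ * X) ((Dmat N)ᵀ * Xhat) s F (by omega)
    (by rw [← Matrix.mul_sub, hFsq]; exact sd_frob_mul N H) hF0
  have c2 := sd_cone (X * Dmat N) (Xhat * Dmat N) s F (by omega)
    (by rw [← Matrix.sub_mul, hFsq]; exact sd_frob_mul' N H) hF0
  rw [← Matrix.mul_sub] at c1
  rw [← Matrix.sub_mul] at c2
  have p2 : 0 ≤ m1 ((Xhat - X) * Dmat N) :=
    Finset.sum_nonneg fun i _ => Finset.sum_nonneg fun j _ => abs_nonneg _
  have hT : m1 ((Dmat N)ᵀ * H * Dmat N) ≤ 16 * (Real.sqrt s * F) := by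
    linarith
  have hfin : F * F ≤ (16 * Real.sqrt s * δ) * F := by
    have := mul_le_mul_of_nonneg_left hT hδ.le
    nlinarith
  rcases hF0.eq_or_lt with h | h
  · rw [← h]; positivity
  · exact le_of_mul_le_mul_right hfin h
end

section
/- Let $X\in[0,1]^{N\times N}$ and let $q\in\mathbb{R}^{N\times N}$ satisfy $\|D^{-1}(X-q)D^{-T}\|_{\max}\leq\delta/2$ for some $\delta>0$. Let $\hat{X}$ be any minimizer of $\|D^T Z\|_1+\|ZD\|_1$ over all $Z\in\mathbb{R}^{N\times N}$ with $\|D^{-1}(Z-q)D^{-T}\|_{\max}\leq\delta/2$. Then for every integer $1\leq s\leq N^2$, $\|\hat{X}-X\|_F\leq C\left(\sqrt{s}\sqrt{\delta}+\sqrt{\sigma_s(D^T X)}+\sqrt{\sigma_s(XD)}\right)\sqrt{\delta}$, where for a matrix $Z$, $\sigma_s(Z)$ is the $\ell_1$-error between the vectorized $Z$ and its best $s$-term approximation, and $C$ is an absolute constant. -/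
open scoped BigOperators
open Finset Matrix

/-- `σ_s(A)`: the entrywise ℓ¹ error of the best `s`-term approximation of `A`. -/
noncomputable def msigmaTail {N : ℕ} (s : ℕ) (A : Matrix (Fin N) (Fin N) ℝ) : ℝ :=
  sInf {t : ℝ | ∃ B : Matrix (Fin N) (Fin N) ℝ, msupp B ≤ s ∧ t = m1 (A - B)}


lemma Dmat_isUnit (N : ℕ) : IsUnit (Dmat N).det := by
  have h : (Dmat N).BlockTriangular OrderDual.toDual := by
    intro i j hij
    have hij' : (i : ℕ) < j := hij
    have h1 : i ≠ j := by intro h; subst h; omega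
    have h2 : ¬ ((j : ℕ) + 1 = i) := by omega
    simp [Dmat, h1, h2]
  rw [Matrix.det_of_lowerTriangular _ h]
  simp [Dmat]

lemma Dmat_abs_le {N : ℕ} (i j : Fin N) :
    |Dmat N i j| ≤ (if i = j then (1 : ℝ) else 0) + (if (j : ℕ) + 1 = (i : ℕ) then 1 else 0) := by
  simp only [Dmat, Matrix.of_apply]
  split_ifs <;> simp

lemma Dmat_row {N : ℕ} (i : Fin N) : ∑ j, |Dmat N i j| ≤ 2 := by
  refine (Finset.sum_le_sum fun j _ => Dmat_abs_le i j).trans ?_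
  rw [Finset.sum_add_distrib]
  have h1 : ∑ j, (if i = j then (1 : ℝ) else 0) = 1 := by simp
  have h2 : ∑ j : Fin N, (if (j : ℕ) + 1 = (i : ℕ) then (1 : ℝ) else 0) ≤ 1 := by
    rw [Finset.sum_boole]
    have : (Finset.univ.filter (fun j : Fin N => (j : ℕ) + 1 = (i : ℕ))).card ≤ 1 := by
      rw [Finset.card_le_one]
      intro a ha b hb
      simp only [Finset.mem_filter] at ha hb
      exact Fin.ext (by omega)
    exact_mod_cast this
  linarith

lemma Dmat_col {N : ℕ} (j : Fin N) : ∑ i, |Dmat N i j| ≤ 2 := by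
  refine (Finset.sum_le_sum fun i _ => Dmat_abs_le i j).trans ?_
  rw [Finset.sum_add_distrib]
  have h1 : ∑ i, (if i = j then (1 : ℝ) else 0) = 1 := by simp
  have h2 : ∑ i : Fin N, (if (j : ℕ) + 1 = (i : ℕ) then (1 : ℝ) else 0) ≤ 1 := by
    rw [Finset.sum_boole]
    have : (Finset.univ.filter (fun i : Fin N => (j : ℕ) + 1 = (i : ℕ))).card ≤ 1 := by
      rw [Finset.card_le_one]
      intro a ha b hb
      simp only [Finset.mem_filter] at ha hb
      exact Fin.ext (by omega)
    exact_mod_cast this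
  linarith

lemma mul_bound_left {N : ℕ} (P A : Matrix (Fin N) (Fin N) ℝ) (hP : ∀ i, ∑ k, |P i k| ≤ 2)
    (c : ℝ) (hA : ∀ i j, |A i j| ≤ c) (i j : Fin N) : |(P * A) i j| ≤ 2 * c := by
  have hc : 0 ≤ c := (abs_nonneg _).trans (hA i j)
  rw [Matrix.mul_apply]
  calc |∑ k, P i k * A k j| ≤ ∑ k, |P i k * A k j| := Finset.abs_sum_le_sum_abs _ _
    _ ≤ ∑ k, |P i k| * c := by
        refine Finset.sum_le_sum fun k _ => ?_
        rw [abs_mul]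
        exact mul_le_mul_of_nonneg_left (hA k j) (abs_nonneg _)
    _ = (∑ k, |P i k|) * c := by rw [Finset.sum_mul]
    _ ≤ 2 * c := mul_le_mul_of_nonneg_right (hP i) hc

lemma mul_bound_right {N : ℕ} (A P : Matrix (Fin N) (Fin N) ℝ) (hP : ∀ j, ∑ k, |P k j| ≤ 2)
    (c : ℝ) (hA : ∀ i j, |A i j| ≤ c) (i j : Fin N) : |(A * P) i j| ≤ 2 * c := by
  have h := mul_bound_left Pᵀ Aᵀ hP c (fun i j => hA j i) j i
  rwa [← Matrix.transpose_mul] at h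

lemma m1_transpose {N : ℕ} (A : Matrix (Fin N) (Fin N) ℝ) : m1 Aᵀ = m1 A := by
  unfold m1
  rw [Finset.sum_comm]
  rfl

lemma m1_mul_right {N : ℕ} (A P : Matrix (Fin N) (Fin N) ℝ) (hP : ∀ k, ∑ j, |P k j| ≤ 2) :
    m1 (A * P) ≤ 2 * m1 A := by
  unfold m1
  rw [Finset.mul_sum]
  refine Finset.sum_le_sum fun i _ => ?_
  calc ∑ j, |(A * P) i j| ≤ ∑ j, ∑ k, |A i k| * |P k j| := by
        refine Finset.sum_le_sum fun j _ => ?_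
        rw [Matrix.mul_apply]
        refine (Finset.abs_sum_le_sum_abs _ _).trans (le_of_eq ?_)
        simp [abs_mul]
    _ = ∑ k, |A i k| * ∑ j, |P k j| := by
        rw [Finset.sum_comm]
        simp [Finset.mul_sum]
    _ ≤ ∑ k, |A i k| * 2 :=
        Finset.sum_le_sum fun k _ => mul_le_mul_of_nonneg_left (hP k) (abs_nonneg _)
    _ = 2 * ∑ k, |A i k| := by rw [← Finset.sum_mul, mul_comm]

lemma m1_mul_left {N : ℕ} (P A : Matrix (Fin N) (Fin N) ℝ) (hP : ∀ k, ∑ i, |P i k| ≤ 2) :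
    m1 (P * A) ≤ 2 * m1 A := by
  have h := m1_mul_right Aᵀ Pᵀ hP
  rwa [← Matrix.transpose_mul, m1_transpose, m1_transpose] at h

/-- The cone-type inequality. -/
lemma cone_ineq {N : ℕ} (A E B : Matrix (Fin N) (Fin N) ℝ) (c : ℝ) (hc : 0 ≤ c)
    (hE : ∀ i j, |E i j| ≤ c)
    (s : ℕ) (hB : msupp B ≤ s) :
    m1 E ≤ m1 (A + E) - m1 A + 2 * m1 (A - B) + 2 * (c * s) := by
  have hs : ∑ i, ∑ j, (if B i j ≠ 0 then c else 0) ≤ c * s := by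
    rw [← Finset.sum_product', ← Finset.sum_filter, Finset.sum_const, nsmul_eq_mul, mul_comm]
    refine mul_le_mul_of_nonneg_left ?_ hc
    exact_mod_cast hB
  have key : m1 E ≤ ∑ i, ∑ j, (|(A + E) i j| - |A i j| + 2 * |(A - B) i j|
      + 2 * (if B i j ≠ 0 then c else 0)) := by
    unfold m1
    refine Finset.sum_le_sum fun i _ => Finset.sum_le_sum fun j _ => ?_
    have h1 : |A i j| ≤ |A i j + E i j| + |E i j| := by
      have := abs_sub (A i j + E i j) (E i j)
      simpa using this
    have h2 : |E i j| ≤ |A i j + E i j| + |A i j| := by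
      have := abs_sub (A i j + E i j) (A i j)
      simpa using this
    have h3 := hE i j
    have h4 := abs_nonneg (A i j - B i j)
    simp only [Matrix.add_apply, Matrix.sub_apply]
    split_ifs with h
    · linarith
    · have h0 : B i j = 0 := by simpa using h
      rw [h0, sub_zero]
      linarith
  simp only [Finset.sum_add_distrib, Finset.sum_sub_distrib, ← Finset.mul_sum] at key
  unfold m1 at *
  linarith

lemma frob_identity {N : ℕ} (D U H : Matrix (Fin N) (Fin N) ℝ) (hH : H = D * U * Dᵀ) (c : ℝ)
    (hU : ∀ i j, |U i j| ≤ c) : ∑ i, ∑ j, (H i j) ^ 2 ≤ c * m1 (Dᵀ * H * D) := by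
  have h1 : ∑ i, ∑ j, (H i j) ^ 2 = Matrix.trace (H * Hᵀ) := by
    simp [Matrix.trace, Matrix.mul_apply, pow_two]
  have h2 : Matrix.trace (H * Hᵀ) = Matrix.trace ((Dᵀ * H * D) * Uᵀ) := by
    conv_lhs => rw [show Hᵀ = D * Uᵀ * Dᵀ by
      rw [hH]; simp [Matrix.transpose_mul, Matrix.mul_assoc]]
    rw [← Matrix.mul_assoc, Matrix.trace_mul_comm]
    simp only [Matrix.mul_assoc]
  rw [h1, h2]
  unfold m1
  simp only [Matrix.trace, Matrix.diag_apply, Matrix.mul_apply (N := Uᵀ), Matrix.transpose_apply,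
    Finset.mul_sum]
  refine Finset.sum_le_sum fun i _ => Finset.sum_le_sum fun j _ => ?_
  refine (le_abs_self _).trans ?_
  rw [abs_mul, mul_comm]
  exact mul_le_mul_of_nonneg_right (hU i j) (abs_nonneg _)

lemma le_msigmaTail {N : ℕ} (s : ℕ) (A : Matrix (Fin N) (Fin N) ℝ) (a : ℝ)
    (h : ∀ B : Matrix (Fin N) (Fin N) ℝ, msupp B ≤ s → a ≤ m1 (A - B)) :
    a ≤ msigmaTail s A := by
  refine le_csInf ⟨_, 0, by simp [msupp], rfl⟩ ?_
  rintro t ⟨B, hB, rfl⟩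
  exact h B hB

lemma m1_nonneg {N : ℕ} (A : Matrix (Fin N) (Fin N) ℝ) : 0 ≤ m1 A :=
  Finset.sum_nonneg fun _ _ => Finset.sum_nonneg fun _ _ => abs_nonneg _

/-- instance-optimal error bound for the 2D TV decoder applied to
a first-order 2D Sigma Delta quantization of an arbitrary image `X ∈ [0,1]^{N×N}`. -/
theorem sigma_delta_2d_decoder_error_compressible :
    ∃ C : ℝ, 0 < C ∧
      ∀ (N : ℕ) (δ : ℝ), 0 < δ →
      ∀ (X q : Matrix (Fin N) (Fin N) ℝ),
        (∀ i j, X i j ∈ Set.Icc (0 : ℝ) 1) →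
        (∀ i j, |((Dmat N)⁻¹ * (X - q) * ((Dmat N)⁻¹)ᵀ) i j| ≤ δ / 2) →
        ∀ Xhat : Matrix (Fin N) (Fin N) ℝ,
          (∀ i j, |((Dmat N)⁻¹ * (Xhat - q) * ((Dmat N)⁻¹)ᵀ) i j| ≤ δ / 2) →
          (∀ Z : Matrix (Fin N) (Fin N) ℝ,
            (∀ i j, |((Dmat N)⁻¹ * (Z - q) * ((Dmat N)⁻¹)ᵀ) i j| ≤ δ / 2) →
            m1 ((Dmat N)ᵀ * Xhat) + m1 (Xhat * Dmat N) ≤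
              m1 ((Dmat N)ᵀ * Z) + m1 (Z * Dmat N)) →
          ∀ s : ℕ, 1 ≤ s → s ≤ N ^ 2 →
            frob (Xhat - X) ≤
              C * (Real.sqrt s * Real.sqrt δ +
                    Real.sqrt (msigmaTail s ((Dmat N)ᵀ * X)) +
                    Real.sqrt (msigmaTail s (X * Dmat N))) * Real.sqrt δ := by
  refine ⟨6, by norm_num, ?_⟩
  intro N δ hδ X q _ hX Xhat hXhat hmin s _ _
  obtain ⟨H, hH⟩ : ∃ H, H = Xhat - X := ⟨_, rfl⟩
  obtain ⟨U, hUdef⟩ : ∃ U, U = (Dmat N)⁻¹ * H * ((Dmat N)⁻¹)ᵀ := ⟨_, rfl⟩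
  have hU : ∀ i j, |U i j| ≤ δ := by
    intro i j
    have hsplit : U = (Dmat N)⁻¹ * (Xhat - q) * ((Dmat N)⁻¹)ᵀ
        - (Dmat N)⁻¹ * (X - q) * ((Dmat N)⁻¹)ᵀ := by
      rw [← Matrix.sub_mul, ← Matrix.mul_sub, hUdef, hH]
      congr 2
      abel
    rw [hsplit, Matrix.sub_apply]
    have := abs_sub (((Dmat N)⁻¹ * (Xhat - q) * ((Dmat N)⁻¹)ᵀ) i j)
      (((Dmat N)⁻¹ * (X - q) * ((Dmat N)⁻¹)ᵀ) i j)
    linarith [hX i j, hXhat i j]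
  have hD := Dmat_isUnit N
  have hHU : H = Dmat N * U * (Dmat N)ᵀ := by
    have e1 : ((Dmat N)⁻¹)ᵀ * (Dmat N)ᵀ = 1 := by
      rw [← Matrix.transpose_mul, Matrix.mul_nonsing_inv _ hD, Matrix.transpose_one]
    rw [hUdef, Matrix.mul_assoc (Dmat N)⁻¹, Matrix.mul_nonsing_inv_cancel_left _ _ hD,
      Matrix.mul_assoc, e1, Matrix.mul_one]
  have hHb : ∀ i j, |H i j| ≤ 2 * (2 * δ) := by
    rw [hHU]
    exact mul_bound_right _ _ Dmat_row _ (mul_bound_left _ _ Dmat_row _ hU)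
  have hE1 : ∀ i j, |((Dmat N)ᵀ * H) i j| ≤ 2 * (2 * (2 * δ)) :=
    mul_bound_left _ _ Dmat_col _ hHb
  have hE2 : ∀ i j, |(H * Dmat N) i j| ≤ 2 * (2 * (2 * δ)) :=
    mul_bound_right _ _ Dmat_col _ hHb
  have hm := hmin X hX
  have hXh : Xhat = X + H := by rw [hH]; abel
  rw [hXh, Matrix.mul_add, Matrix.add_mul] at hm
  have hfr := frob_identity (Dmat N) U H hHU δ hU
  have hl : m1 ((Dmat N)ᵀ * H * Dmat N) ≤ 2 * m1 ((Dmat N)ᵀ * H) := m1_mul_right _ _ Dmat_row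
  have hr : m1 ((Dmat N)ᵀ * H * Dmat N) ≤ 2 * m1 (H * Dmat N) := by
    rw [Matrix.mul_assoc]
    exact m1_mul_left _ _ Dmat_row
  have hc : 0 ≤ 2 * (2 * (2 * δ)) := by positivity
  obtain ⟨M, hM⟩ : ∃ M, M = m1 ((Dmat N)ᵀ * H * Dmat N) := ⟨_, rfl⟩
  obtain ⟨a, ha⟩ : ∃ a, a = msigmaTail s ((Dmat N)ᵀ * X) := ⟨_, rfl⟩
  obtain ⟨b, hb⟩ : ∃ b, b = msigmaTail s (X * Dmat N) := ⟨_, rfl⟩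
  have hmain : M ≤ 32 * (δ * s) + 2 * a + 2 * b := by
    have h1 : (M - 32 * (δ * s) - 2 * b) / 2 ≤ a := by
      rw [ha]
      refine le_msigmaTail _ _ _ fun B1 hB1 => ?_
      have h2 : (M - 32 * (δ * s) - 2 * m1 ((Dmat N)ᵀ * X - B1)) / 2 ≤ b := by
        rw [hb]
        refine le_msigmaTail _ _ _ fun B2 hB2 => ?_
        have c1 := cone_ineq ((Dmat N)ᵀ * X) _ B1 _ hc hE1 s hB1
        have c2 := cone_ineq (X * Dmat N) _ B2 _ hc hE2 s hB2
        rw [← hM] at hl hr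
        linarith
      linarith
    linarith
  have ha0 : 0 ≤ a := ha ▸ le_msigmaTail _ _ _ fun B _ => m1_nonneg _
  have hb0 : 0 ≤ b := hb ▸ le_msigmaTail _ _ _ fun B _ => m1_nonneg _
  rw [← hH, ← ha, ← hb]
  unfold frob
  refine Real.sqrt_le_iff.2 ⟨by positivity, ?_⟩
  rw [← hM] at hfr
  have hs0 : (0 : ℝ) ≤ s := Nat.cast_nonneg s
  have e1 := Real.sq_sqrt hs0
  have e2 := Real.sq_sqrt hδ.le
  have e3 := Real.sq_sqrt ha0
  have e4 := Real.sq_sqrt hb0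
  have p1 := Real.sqrt_nonneg (s : ℝ)
  have p2 := Real.sqrt_nonneg δ
  have p3 := Real.sqrt_nonneg a
  have p4 := Real.sqrt_nonneg b
  have hsq : δ * s + a + b ≤ (√(s : ℝ) * √δ + √a + √b) ^ 2 := by
    have : δ * s = (√(s : ℝ) * √δ) ^ 2 := by rw [mul_pow, e1, e2]; ring
    rw [this]
    nth_rewrite 1 [← e3]
    nth_rewrite 1 [← e4]
    have p5 := mul_nonneg p1 p2
    nlinarith [mul_nonneg p5 p3, mul_nonneg p5 p4, mul_nonneg p3 p4]
  rw [mul_pow, mul_pow, e2]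
  refine hfr.trans ?_
  rw [mul_comm]
  refine mul_le_mul_of_nonneg_right ?_ hδ.le
  have : 0 ≤ δ * s := by positivity
  linarith
end
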